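/- arXiv:1407.5289 — 2 statements merged into one kernel-verified Lean document; each statement's English description precedes it below -/
import Mathlib

section
/- Let (X,d) be a metric space, let μ be a Borel measure on X, let x₀ ∈ X, let N ∈ (1,∞) and θ ∈ (0,∞). Define the boundary measure s(x₀,r) := limsup_{δ→0⁺} μ(B(x₀,r+δ) \ B(x₀,r))/δ ∈ [0,∞]. Assume: (i) for all 0 < r < R one has s(x₀,R)·r^{N-1} ≤ s(x₀,r)·R^{N-1} (i.e. s(x₀,R)/s(x₀,r) ≤ (R/r)^{N-1}); (ii) for every R > 0, μ(B(x₀,R)) = ∫₀^R s(x₀,r) dr; (iii) liminf_{R→∞} μ(B(x₀,R))/R^N = θ. Then for every R > 0 it holds s(x₀,R) ≥ N θ R^{N-1}. -/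
open MeasureTheory Metric Filter Set

/-- If the boundary measure `s(x₀,r) := limsup_{δ→0⁺} μ(B(x₀,r+δ) \ B(x₀,r))/δ`
satisfies the Bishop–Gromov type monotonicity `s(x₀,R)/s(x₀,r) ≤ (R/r)^{N-1}`, the co-area
identity `μ(B(x₀,R)) = ∫₀^R s(x₀,r) dr`, and `liminf_{R→∞} μ(B(x₀,R))/R^N = θ ∈ (0,∞)`,
then `s(x₀,R) ≥ N θ R^{N-1}` for every `R > 0`. -/
theorem boundary_measure_lower_bound
    {X : Type*} [MetricSpace X] [MeasurableSpace X] [BorelSpace X]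
    (μ : Measure X) (x₀ : X) (N θ : ℝ) (hN : 1 < N) (hθ : 0 < θ)
    (s : ℝ → ENNReal)
    (hs : ∀ r : ℝ, s r =
      Filter.limsup (fun δ : ℝ => μ (ball x₀ (r + δ) \ ball x₀ r) / ENNReal.ofReal δ)
        (nhdsWithin 0 (Set.Ioi 0)))
    (hmono : ∀ r R : ℝ, 0 < r → r < R →
      s R * ENNReal.ofReal (r ^ (N - 1)) ≤ s r * ENNReal.ofReal (R ^ (N - 1)))
    (hcoarea : ∀ R : ℝ, 0 < R → μ (ball x₀ R) = ∫⁻ r in Set.Ioc (0 : ℝ) R, s r)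
    (hliminf : Filter.liminf
      (fun R : ℝ => μ (ball x₀ R) / ENNReal.ofReal (R ^ N)) Filter.atTop
      = ENNReal.ofReal θ) :
    ∀ R : ℝ, 0 < R → ENNReal.ofReal (N * θ * R ^ (N - 1)) ≤ s R := by
  intro R₀ hR₀
  by_cases htop : s R₀ = ⊤
  · rw [htop]; exact le_top
  have hp : 0 < R₀ ^ (N - 1) := Real.rpow_pos_of_pos hR₀ _
  obtain ⟨c, hc⟩ : ∃ c : ℝ, c = (s R₀).toReal / R₀ ^ (N - 1) := ⟨_, rfl⟩
  have hc0 : 0 ≤ c := by rw [hc]; positivity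
  have hsR : s R₀ = ENNReal.ofReal (c * R₀ ^ (N - 1)) := by
    rw [hc, div_mul_cancel₀ _ hp.ne', ENNReal.ofReal_toReal htop]
  -- pointwise bound beyond R₀
  have hbd : ∀ r, R₀ < r → s r ≤ ENNReal.ofReal (c * r ^ (N - 1)) := by
    intro r hr
    have h := hmono R₀ r hR₀ hr
    have hr0 : 0 < r ^ (N - 1) := Real.rpow_pos_of_pos (hR₀.trans hr) _
    have h2 : s R₀ * ENNReal.ofReal (r ^ (N - 1))
        = ENNReal.ofReal (c * r ^ (N - 1)) * ENNReal.ofReal (R₀ ^ (N - 1)) := by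
      rw [hsR, ← ENNReal.ofReal_mul (by positivity), ← ENNReal.ofReal_mul (by positivity)]
      congr 1; ring
    rw [h2] at h
    exact (ENNReal.mul_le_mul_iff_left (by simpa using hp) ENNReal.ofReal_ne_top).1 h
  -- finiteness of the ball
  have hfin : μ (ball x₀ R₀) ≠ ⊤ := by
    intro hinf
    have hev : ∀ᶠ R : ℝ in atTop, (⊤ : ENNReal) ≤ μ (ball x₀ R) / ENNReal.ofReal (R ^ N) := by
      filter_upwards [eventually_ge_atTop R₀] with R hR
      have : μ (ball x₀ R) = ⊤ := top_le_iff.1 (hinf ▸ measure_mono (ball_subset_ball hR))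
      rw [this, ENNReal.top_div_of_ne_top ENNReal.ofReal_ne_top]
    have := le_liminf_of_le (by isBoundedDefault) hev
    rw [hliminf] at this
    exact ENNReal.ofReal_ne_top (top_le_iff.1 this)
  have hint : ∀ R, R₀ < R → ∫⁻ r in Ioc R₀ R, s r ≤ ENNReal.ofReal (c * (R ^ N / N)) := by
    intro R hR
    have hRpos := hR₀.trans hR
    calc ∫⁻ r in Ioc R₀ R, s r ≤ ∫⁻ r in Ioc R₀ R, ENNReal.ofReal (c * r ^ (N - 1)) :=
          setLIntegral_mono' measurableSet_Ioc fun r hr => hbd r hr.1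
      _ ≤ ∫⁻ r in Ioc 0 R, ENNReal.ofReal (c * r ^ (N - 1)) :=
          lintegral_mono_set (Ioc_subset_Ioc_left hR₀.le)
      _ = ENNReal.ofReal (∫ r in Ioc 0 R, c * r ^ (N - 1)) := by
          rw [ofReal_integral_eq_lintegral_ofReal]
          · have : IntervalIntegrable (fun r : ℝ => c * r ^ (N - 1)) volume 0 R :=
              (intervalIntegral.intervalIntegrable_rpow' (by linarith)).const_mul c
            exact (intervalIntegrable_iff_integrableOn_Ioc_of_le hRpos.le).1 this
          · filter_upwards [ae_restrict_mem measurableSet_Ioc] with r hr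
            exact mul_nonneg hc0 (Real.rpow_nonneg hr.1.le _)
      _ = ENNReal.ofReal (c * (R ^ N / N)) := by
          rw [← intervalIntegral.integral_of_le hRpos.le, intervalIntegral.integral_const_mul,
            integral_rpow (Or.inl (by linarith)), sub_add_cancel,
            Real.zero_rpow (by linarith), sub_zero]
  obtain ⟨M, hM⟩ : ∃ M : ℝ, M = (μ (ball x₀ R₀)).toReal := ⟨_, rfl⟩
  have hM0 : 0 ≤ M := by rw [hM]; positivity
  have hev : ∀ᶠ R : ℝ in atTop, μ (ball x₀ R) / ENNReal.ofReal (R ^ N)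
      ≤ ENNReal.ofReal (M / R ^ N + c / N) := by
    filter_upwards [eventually_gt_atTop R₀] with R hR
    have hRpos := hR₀.trans hR
    have hRN : 0 < R ^ N := Real.rpow_pos_of_pos hRpos _
    have h1 : μ (ball x₀ R) ≤ ENNReal.ofReal (M + c * (R ^ N / N)) := by
      rw [ENNReal.ofReal_add hM0 (by positivity), hM, ENNReal.ofReal_toReal hfin,
        hcoarea R hRpos, hcoarea R₀ hR₀, ← Ioc_union_Ioc_eq_Ioc hR₀.le hR.le]
      exact (lintegral_union_le _ _ _).trans (add_le_add le_rfl (hint R hR))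
    calc _ ≤ ENNReal.ofReal (M + c * (R ^ N / N)) / ENNReal.ofReal (R ^ N) := by gcongr
      _ = _ := by
        rw [← ENNReal.ofReal_div_of_pos hRN]
        congr 1
        field_simp
  have hlim : Tendsto (fun R : ℝ => ENNReal.ofReal (M / R ^ N + c / N)) atTop
      (nhds (ENNReal.ofReal (c / N))) := by
    apply ENNReal.tendsto_ofReal
    have := ((tendsto_rpow_atTop (show 0 < N by linarith)).const_div_atTop M).add_const (c / N)
    simpa using this
  have hle : ENNReal.ofReal θ ≤ ENNReal.ofReal (c / N) := by
    rw [← hliminf, ← hlim.liminf_eq]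
    exact liminf_le_liminf hev
  have hN0 : 0 < N := by linarith
  have h3 : θ ≤ c / N := (ENNReal.ofReal_le_ofReal_iff (by positivity)).1 hle
  rw [le_div_iff₀ hN0] at h3
  rw [hsR]
  apply ENNReal.ofReal_le_ofReal
  apply mul_le_mul_of_nonneg_right _ hp.le
  linarith
end

section
/- Let (X,d) be a metric space and μ a Borel measure on X which is finite on bounded sets. Let x₀ ∈ X be such that μ({x₀}) = 0 and such that the function r ↦ μ(B(x₀,r)) is locally Lipschitz continuous on (0,∞). Let f : X → ℝ be measurable and essentially bounded on every bounded subset of X. Then for every R > 0, ∫_{B(x₀,R)} f dμ = ∫₀^R |f|_{∂B(x₀,r)} dr, where |f|_{∂B(x₀,r)} := limsup_{δ→0⁺} (1/δ)·∫_{B(x₀,r+δ) \ B(x₀,r)} f dμ. -/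
open MeasureTheory Metric Filter Set

/-- co-area formula: If `μ` is a Borel measure finite on bounded sets,
`μ({x₀}) = 0`, `r ↦ μ(B(x₀,r))` is locally Lipschitz on `(0,∞)`, and `f : X → ℝ` is
measurable and essentially bounded on every bounded set, then for every `R > 0`,
`∫_{B(x₀,R)} f dμ = ∫₀^R |f|_{∂B(x₀,r)} dr`, where
`|f|_{∂B(x₀,r)} := limsup_{δ→0⁺} (1/δ) ∫_{B(x₀,r+δ) \ B(x₀,r)} f dμ`. -/
theorem coarea_formula_boundary_integral
    {X : Type*} [MetricSpace X] [MeasurableSpace X] [BorelSpace X]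
    (μ : Measure X) (x₀ : X)
    (hfin : ∀ A : Set X, Bornology.IsBounded A → μ A < ⊤)
    (hx₀ : μ {x₀} = 0)
    (hlip : ∀ a b : ℝ, 0 < a → a < b →
      ∃ L : NNReal, LipschitzOnWith L (fun r : ℝ => (μ (ball x₀ r)).toReal) (Set.Icc a b))
    (f : X → ℝ) (hfmeas : Measurable f)
    (hfbdd : ∀ A : Set X, Bornology.IsBounded A →
      ∃ C : ℝ, ∀ᵐ x ∂(μ.restrict A), |f x| ≤ C)
    (bd : ℝ → ℝ)
    (hbd : ∀ r : ℝ, bd r =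
      Filter.limsup
        (fun δ : ℝ => (1 / δ) * ∫ x in ball x₀ (r + δ) \ ball x₀ r, f x ∂μ)
        (nhdsWithin 0 (Set.Ioi 0))) :
    ∀ R : ℝ, 0 < R →
      ∫ x in ball x₀ R, f x ∂μ = ∫ r in Set.Ioc (0 : ℝ) R, bd r := by
  intro R hR
  set m : ℝ → ℝ := fun r => (μ (ball x₀ r)).toReal with hm
  set F : ℝ → ℝ := fun r => ∫ x in ball x₀ r, f x ∂μ with hF
  obtain ⟨C₀, hC₀⟩ := hfbdd (ball x₀ (R + 1)) isBounded_ball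
  set C : ℝ := max C₀ 0 with hC
  have hCnn : 0 ≤ C := le_max_right _ _
  have hCb : ∀ᵐ x ∂(μ.restrict (ball x₀ (R + 1))), ‖f x‖ ≤ C := by
    filter_upwards [hC₀] with x hx
    exact hx.trans (le_max_left _ _)
  have hbfin : ∀ r, μ (ball x₀ r) < ⊤ := fun r => hfin _ isBounded_ball
  have hint : ∀ r, IntegrableOn f (ball x₀ r) μ := by
    intro r
    obtain ⟨K, hK⟩ := hfbdd (ball x₀ r) isBounded_ball
    exact IntegrableOn.of_bound (hbfin r) hfmeas.aestronglyMeasurable K hK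
  have hFdiff : ∀ r s, r ≤ s → ∫ x in ball x₀ s \ ball x₀ r, f x ∂μ = F s - F r := by
    intro r s hrs
    exact setIntegral_sdiff measurableSet_ball (hint s) (ball_subset_ball hrs)
  have hmdiff : ∀ r s, r ≤ s → μ.real (ball x₀ s \ ball x₀ r) = m s - m r := by
    intro r s hrs
    exact measureReal_sdiff (ball_subset_ball hrs) measurableSet_ball (hbfin s).ne
  have hFm : ∀ r s, r ≤ s → s ≤ R + 1 → |F s - F r| ≤ C * (m s - m r) := by
    intro r s hrs hs
    rw [← hFdiff r s hrs, ← hmdiff r s hrs, ← Real.norm_eq_abs]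
    refine norm_setIntegral_le_of_norm_le_const_ae
      ((measure_mono sdiff_subset).trans_lt (hbfin s)) ?_
    exact ae_restrict_of_ae_restrict_of_subset
      (sdiff_subset.trans (ball_subset_ball hs)) hCb
  have hmnn : ∀ r, 0 ≤ m r := fun r => ENNReal.toReal_nonneg
  -- the main local statement
  have key : ∀ a, 0 < a → a < R → IntervalIntegrable bd volume a R ∧
      (∫ r in a..R, bd r = F R - F a) ∧ ∫ r in a..R, ‖bd r‖ ≤ C * m R := by
    intro a ha haR
    obtain ⟨L, hL⟩ := hlip a R ha haR
    have hmac : AbsolutelyContinuousOnInterval m a R := by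
      apply LipschitzOnWith.absolutelyContinuousOnInterval (K := L)
      rwa [uIcc_of_le haR.le]
    have hFac : AbsolutelyContinuousOnInterval F a R := by
      apply LipschitzOnWith.absolutelyContinuousOnInterval (K := C.toNNReal * L)
      rw [uIcc_of_le haR.le]
      have aux : ∀ x ∈ Icc a R, ∀ y ∈ Icc a R, x ≤ y →
          |F y - F x| ≤ C * (L * |y - x|) := by
        intro x hx y hy hxy
        refine (hFm x y hxy (by linarith [hy.2])).trans ?_
        refine mul_le_mul_of_nonneg_left ?_ hCnn
        exact (le_abs_self _).trans (hL.dist_le_mul y hy x hx)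
      refine LipschitzOnWith.of_dist_le_mul ?_
      intro x hx y hy
      rw [NNReal.coe_mul, Real.coe_toNNReal _ hCnn, mul_assoc, Real.dist_eq, Real.dist_eq]
      rcases le_total x y with h | h
      · rw [abs_sub_comm (F x), abs_sub_comm x]; exact aux x hx y hy h
      · exact aux y hy x hx h
    have hae : ∀ᵐ r, r ∈ uIoc a R → deriv F r = bd r ∧ ‖bd r‖ ≤ C * deriv m r := by
      filter_upwards [hmac.ae_differentiableAt, hFac.ae_differentiableAt] with r h1 h2 hr
      have hr' := uIoc_subset_uIcc hr
      have t1 := (h1 hr').hasDerivAt.tendsto_slope_zero_right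
      have t2 := (h2 hr').hasDerivAt.tendsto_slope_zero_right
      have e : deriv F r = bd r := by
        rw [hbd r]
        symm
        apply Tendsto.limsup_eq
        refine t2.congr' ?_
        filter_upwards [self_mem_nhdsWithin] with δ hδ
        have hδ' : (0 : ℝ) < δ := hδ
        rw [hFdiff r (r + δ) (by linarith), smul_eq_mul, one_div]
      refine ⟨e, ?_⟩
      rw [← e]
      refine le_of_tendsto_of_tendsto t2.norm (t1.const_mul C) ?_
      have hlt : ∀ᶠ δ : ℝ in nhdsWithin 0 (Ioi 0), δ < 1 :=
        nhdsWithin_le_nhds (Iio_mem_nhds one_pos)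
      filter_upwards [self_mem_nhdsWithin, hlt] with δ hδ hδ1
      have hδ' : (0 : ℝ) < δ := hδ
      rw [uIoc_of_le haR.le] at hr
      have := hFm r (r + δ) (by linarith) (by linarith [hr.2])
      rw [smul_eq_mul, smul_eq_mul, norm_mul, Real.norm_of_nonneg (inv_nonneg.2 hδ'.le)]
      calc δ⁻¹ * ‖F (r + δ) - F r‖ ≤ δ⁻¹ * (C * (m (r + δ) - m r)) :=
            mul_le_mul_of_nonneg_left this (inv_nonneg.2 hδ'.le)
        _ = _ := by ring
    have hii : IntervalIntegrable bd volume a R := by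
      refine hFac.intervalIntegrable_deriv.congr_ae ?_
      refine (ae_restrict_iff' measurableSet_uIoc).2 ?_
      filter_upwards [hae] with r hr h using (hr h).1
    refine ⟨hii, ?_, ?_⟩
    · rw [← hFac.integral_deriv_eq_sub]
      refine intervalIntegral.integral_congr_ae ?_
      filter_upwards [hae] with r hr h using (hr h).1.symm
    · calc ∫ r in a..R, ‖bd r‖ ≤ ∫ r in a..R, C * deriv m r := by
            rw [intervalIntegral.integral_of_le haR.le, intervalIntegral.integral_of_le haR.le]
            refine integral_mono_ae hii.1.norm (hmac.intervalIntegrable_deriv.1.const_mul C) ?_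
            refine (ae_restrict_iff' measurableSet_Ioc).2 ?_
            filter_upwards [hae] with r hr h
            exact (hr (by rwa [uIoc_of_le haR.le])).2
        _ = C * (m R - m a) := by
            rw [intervalIntegral.integral_const_mul, hmac.integral_deriv_eq_sub]
        _ ≤ C * m R := mul_le_mul_of_nonneg_left (by linarith [hmnn a]) hCnn
  -- a sequence decreasing to zero
  set a : ℕ → ℝ := fun n => R / ((n : ℝ) + 2) with hadef
  have ha0 : ∀ n, 0 < a n := fun n => by positivity
  have haR : ∀ n, a n < R := fun n => by
    have : (0 : ℝ) ≤ n := n.cast_nonneg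
    exact div_lt_self hR (by linarith)
  have hat : Tendsto a atTop (nhds 0) :=
    tendsto_const_nhds.div_atTop (tendsto_atTop_add_const_right _ _ tendsto_natCast_atTop_atTop)
  have hbdint : IntegrableOn bd (Ioc 0 R) volume := by
    refine integrableOn_Ioc_of_intervalIntegral_norm_bounded_left (l := atTop) (a := a)
      (I := C * m R) (fun n => (key _ (ha0 n) (haR n)).1.1) hat (Eventually.of_forall fun n => ?_)
    rw [← intervalIntegral.integral_of_le (haR n).le]
    exact (key _ (ha0 n) (haR n)).2.2
  have hm0 : Tendsto (fun n => m (a n)) atTop (nhds 0) := by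
    have h := tendsto_measure_biInter_gt (μ := μ) (s := fun r : ℝ => ball x₀ r) (a := 0)
      (fun r _ => measurableSet_ball.nullMeasurableSet)
      (fun i j _ hij => ball_subset_ball hij) ⟨1, one_pos, (hbfin 1).ne⟩
    have hI : (⋂ r : ℝ, ⋂ (_ : r > 0), ball x₀ r) = {x₀} := by
      ext x
      simp only [mem_iInter, mem_ball, mem_singleton_iff]
      constructor
      · intro h
        by_contra hne
        exact lt_irrefl _ (h _ (dist_pos.2 hne))
      · rintro rfl r hr
        simpa using hr
    rw [hI, hx₀] at h
    have h2 : Tendsto a atTop (nhdsWithin 0 (Ioi 0)) :=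
      tendsto_nhdsWithin_iff.2 ⟨hat, Eventually.of_forall ha0⟩
    have h3 := (ENNReal.tendsto_toReal ENNReal.zero_ne_top).comp (h.comp h2)
    rw [ENNReal.toReal_zero] at h3
    exact h3
  have hF0 : Tendsto (fun n => F (a n)) atTop (nhds 0) := by
    refine squeeze_zero_norm (a := fun n => C * m (a n)) (fun n => ?_) (by simpa using hm0.const_mul C)
    have := hFm 0 (a n) (ha0 n).le (by linarith [haR n])
    simpa [hF, hm] using this
  have hlim1 : Tendsto (fun n => ∫ r in (a n)..R, bd r) atTop (nhds (F R)) := by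
    have : (fun n => ∫ r in (a n)..R, bd r) = fun n => F R - F (a n) := by
      funext n; exact (key _ (ha0 n) (haR n)).2.1
    rw [this]
    simpa using hF0.const_sub (F R)
  have hlim2 : Tendsto (fun n => ∫ r in (a n)..R, bd r) atTop (nhds (∫ r in (0 : ℝ)..R, bd r)) := by
    have hc := intervalIntegral.continuousOn_primitive_interval_left (a := 0) (b := R) (f := bd)
      (μ := volume) (by rw [uIcc_of_le hR.le, integrableOn_Icc_iff_integrableOn_Ioc]; exact hbdint)
    have := hc 0 left_mem_uIcc
    refine Tendsto.comp this (tendsto_nhdsWithin_iff.2 ⟨hat, Eventually.of_forall fun n => ?_⟩)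
    rw [uIcc_of_le hR.le]
    exact ⟨(ha0 n).le, (haR n).le⟩
  rw [← intervalIntegral.integral_of_le hR.le]
  exact tendsto_nhds_unique hlim1 hlim2
end
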